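/- arXiv:1407.7208 — 5 statements merged into one kernel-verified Lean document; each statement's English description precedes it below -/
import Mathlib

section
/- If G₁ and G₂ are finite simple graphs each admitting an integer additive set-indexer, then their disjoint union G₁ ∪ G₂ also admits an integer additive set-indexer. -/
open scoped Pointwise

theorem Finset.add_singleton_injective {M : Type*} [DecidableEq M] [Add M]
    [IsRightCancelAdd M] (a : M) : Function.Injective fun s : Finset M => s + {a} := by
  intro s t h
  exact Finset.image_injective (add_left_injective a) <|
    Finset.image₂_singleton_right.symm.trans (h.trans Finset.image₂_singleton_right)

/-- A finite family of finite sets of natural numbers has a common strict upper bound. -/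
theorem exists_forall_mem_lt {V : Type*} [Fintype V] (f : V → Finset ℕ) :
    ∃ N, ∀ v, ∀ x ∈ f v, x < N := by
  refine ⟨(Finset.univ.biUnion f).sup id + 1, fun v x hx => Nat.lt_succ_of_le ?_⟩
  exact Finset.le_sup (f := id) (Finset.mem_biUnion.2 ⟨v, Finset.mem_univ v, hx⟩)

/-- Sumsets of sets lying below `N` differ from sumsets of nonempty sets translated by `N`. -/
theorem add_ne_add_of_lt_of_translate {N : ℕ} {A B C D : Finset ℕ} (hA : ∀ x ∈ A, x < N)
    (hB : ∀ x ∈ B, x < N) (hC : C.Nonempty) (hD : D.Nonempty) :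
    A + B ≠ (C + {N}) + (D + {N}) := by
  intro h
  obtain ⟨c, hc⟩ := hC
  obtain ⟨d, hd⟩ := hD
  have hmem : (c + N) + (d + N) ∈ A + B := h ▸ Finset.add_mem_add
    (Finset.add_mem_add hc (Finset.mem_singleton_self N))
    (Finset.add_mem_add hd (Finset.mem_singleton_self N))
  obtain ⟨a, ha, b, hb, hab⟩ := Finset.mem_add.1 hmem
  have := hA a ha
  have := hB b hb
  omega

/-- The disjoint union of two IASI graphs admits an IASI. -/
theorem disjoint_union_admits_IASI {V₁ V₂ : Type*} [Fintype V₁] [Fintype V₂]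
    (G₁ : SimpleGraph V₁) (G₂ : SimpleGraph V₂)
    (h₁ : ∃ f : V₁ → Finset ℕ, Function.Injective f ∧ (∀ v, (f v).Nonempty) ∧
      ∀ u v u' v', G₁.Adj u v → G₁.Adj u' v' →
        f u + f v = f u' + f v' → s(u, v) = s(u', v'))
    (h₂ : ∃ f : V₂ → Finset ℕ, Function.Injective f ∧ (∀ v, (f v).Nonempty) ∧
      ∀ u v u' v', G₂.Adj u v → G₂.Adj u' v' →
        f u + f v = f u' + f v' → s(u, v) = s(u', v')) :
    ∃ f : V₁ ⊕ V₂ → Finset ℕ, Function.Injective f ∧ (∀ v, (f v).Nonempty) ∧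
      ∀ u v u' v', (G₁ ⊕g G₂).Adj u v → (G₁ ⊕g G₂).Adj u' v' →
        f u + f v = f u' + f v' → s(u, v) = s(u', v') := by
  obtain ⟨f₁, inj₁, ne₁, edge₁⟩ := h₁
  obtain ⟨f₂, inj₂, ne₂, edge₂⟩ := h₂
  obtain ⟨N, hN⟩ := exists_forall_mem_lt f₁
  have hne (u v u' v') := add_ne_add_of_lt_of_translate (hN u) (hN v) (ne₂ u') (ne₂ v')
  refine ⟨Sum.elim f₁ fun v => f₂ v + {N}, ?_, ?_, ?_⟩
  · refine inj₁.sumElim ((Finset.add_singleton_injective N).comp inj₂) fun u v h => ?_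
    obtain ⟨x, hx⟩ := ne₂ v
    have hlt := hN u (x + N) (h ▸ Finset.add_mem_add hx (Finset.mem_singleton_self N))
    omega
  · rintro (v | v)
    · exact ne₁ v
    · exact (ne₂ v).add (Finset.singleton_nonempty N)
  · rintro (u | u) (v | v) (u' | u') (v' | v') huv huv' h <;>
      simp only [SimpleGraph.sum_adj] at huv huv'
    · simpa using congrArg (Sym2.map (Sum.inl (β := V₂))) (edge₁ u v u' v' huv huv' h)
    · exact absurd h (hne u v u' v')
    · exact absurd h.symm (hne u' v' u v)
    · simp only [Sum.elim_inr, add_add_add_comm _ {N}, Finset.singleton_add_singleton] at h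
      simpa using congrArg (Sym2.map (Sum.inr (α := V₁)))
        (edge₂ u v u' v' huv huv' (Finset.add_singleton_injective _ h))
end

section
/- A finite connected simple graph G admits a weakly uniform integer additive set-indexer (i.e., an IASI f together with an integer k ≥ 2 such that for every edge uv of G one has |f⁺(uv)| = k and |f⁺(uv)| = max(|f(u)|, |f(v)|)) if and only if G is bipartite. -/
open scoped Pointwise

/-- A sumset `{a} + {0, d + 1}` determines both `a` and `d`. -/
theorem singleton_add_pair_inj {a d a' d' : ℕ}
    (h : ({a} : Finset ℕ) + {0, d + 1} = {a'} + {0, d' + 1}) : a = a' ∧ d = d' := by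
  have hmem : ∀ b e x, x ∈ ({b} : Finset ℕ) + {0, e + 1} ↔ x = b ∨ x = b + (e + 1) := by
    intro b e x
    simp [Finset.mem_add, eq_comm]
  simp only [Finset.ext_iff, hmem] at h
  have h1 := (h a).1 (by simp)
  have h2 := (h (a + (d + 1))).1 (by simp)
  have h3 := (h a').2 (by simp)
  have h4 := (h (a' + (d' + 1))).2 (by simp)
  omega

theorem card_singleton_add_pair (a d : ℕ) :
    (({a} : Finset ℕ) + {0, d + 1}).card = 2 := by
  rw [Finset.card_singleton_add, Finset.card_pair (by omega)]

/-- If a sumset of nonempty finite sets of naturals is only as large as its larger summand,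
then one of the summands is a singleton. -/
theorem card_eq_one_or_card_eq_one_of_card_add_eq_max {A B : Finset ℕ} (hA : A.Nonempty)
    (hB : B.Nonempty) (h : (A + B).card = max A.card B.card) : A.card = 1 ∨ B.card = 1 := by
  have := cauchy_davenport_add_of_linearOrder_isCancelAdd hA hB
  have := hA.card_pos
  have := hB.card_pos
  omega

/-- A finite connected simple graph admits a weakly uniform IASI
(an IASI `f` and `k ≥ 2` with `|f⁺(uv)| = k = max |f u| |f v|` for every edge)
iff it is bipartite. -/
theorem weakly_uniform_IASI_iff_bipartite {V : Type*} [Fintype V] (G : SimpleGraph V)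
    (hconn : G.Connected) :
    (∃ (f : V → Finset ℕ) (k : ℕ), Function.Injective f ∧ (∀ v, (f v).Nonempty) ∧
      (∀ u v u' v', G.Adj u v → G.Adj u' v' →
        f u + f v = f u' + f v' → s(u, v) = s(u', v')) ∧
      2 ≤ k ∧
      (∀ u v, G.Adj u v → (f u + f v).card = k ∧
        (f u + f v).card = max (f u).card (f v).card)) ↔
    G.Colorable 2 := by
  constructor
  · rintro ⟨f, k, -, hne, -, hk, hcard⟩
    refine ⟨SimpleGraph.Coloring.mk (fun v => if (f v).card = 1 then 0 else 1) ?_⟩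
    intro u v huv
    obtain ⟨h1, h2⟩ := hcard u v huv
    have h3 := card_eq_one_or_card_eq_one_of_card_add_eq_max (hne u) (hne v) h2
    split_ifs <;> omega
  · rintro ⟨c⟩
    let e := Fintype.equivFin V
    have he : ∀ {u v}, (e u : ℕ) = e v → u = v := fun h => e.injective (Fin.ext h)
    let f : V → Finset ℕ := fun v => if c v = 0 then {(e v : ℕ)} else {0, (e v : ℕ) + 1}
    have hf₀ : ∀ {v}, c v = 0 → f v = {(e v : ℕ)} := fun h => if_pos h
    have hf₁ : ∀ {v}, c v ≠ 0 → f v = {0, (e v : ℕ) + 1} := fun h => if_neg h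
    have hcard₀ : ∀ {v}, c v = 0 → (f v).card = 1 := fun h => by simp [hf₀ h]
    have hcard₁ : ∀ {v}, c v ≠ 0 → (f v).card = 2 := fun h => by
      rw [hf₁ h, Finset.card_pair (by omega)]
    have hadj : ∀ {u v}, G.Adj u v → (c u = 0 ∧ c v ≠ 0) ∨ (c v = 0 ∧ c u ≠ 0) := by
      intro u v huv
      have := c.valid huv
      omega
    have hinj : ∀ {u v u' v'}, c u = 0 → c v ≠ 0 → c u' = 0 → c v' ≠ 0 →
        f u + f v = f u' + f v' → u = u' ∧ v = v' := by
      intro u v u' v' hu hv hu' hv' h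
      rw [hf₀ hu, hf₁ hv, hf₀ hu', hf₁ hv'] at h
      exact (singleton_add_pair_inj h).imp he he
    have hsum : ∀ {u v}, c u = 0 → c v ≠ 0 → (f u + f v).card = 2 := by
      intro u v hu hv
      rw [hf₀ hu, hf₁ hv, card_singleton_add_pair]
    refine ⟨f, 2, ?_, ?_, ?_, le_rfl, ?_⟩
    · intro u v h
      by_cases hu : c u = 0 <;> by_cases hv : c v = 0
      · rw [hf₀ hu, hf₀ hv] at h
        exact he (Finset.singleton_injective h)
      · have := hcard₀ hu
        rw [h, hcard₁ hv] at this
        omega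
      · have := hcard₁ hu
        rw [h, hcard₀ hv] at this
        omega
      · rw [hf₁ hu, hf₁ hv] at h
        exact he (singleton_add_pair_inj (a := 0) (a' := 0) (by rw [h])).2
    · intro v
      by_cases hv : c v = 0
      · simp [hf₀ hv]
      · simp [hf₁ hv]
    · intro u v u' v' huv huv' h
      rw [Sym2.eq_iff]
      rcases hadj huv with ⟨hu, hv⟩ | ⟨hv, hu⟩ <;>
        rcases hadj huv' with ⟨hu', hv'⟩ | ⟨hv', hu'⟩
      · exact .inl (hinj hu hv hu' hv' h)
      · exact .inr (hinj hu hv hv' hu' (by rw [h, add_comm]))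
      · exact .inr (hinj hv hu hu' hv' (by rw [← h, add_comm])).symm
      · exact .inl (hinj hv hu hv' hu' (by rw [add_comm, h, add_comm])).symm
    · intro u v huv
      rcases hadj huv with ⟨hu, hv⟩ | ⟨hv, hu⟩
      · rw [hsum hu hv, hcard₀ hu, hcard₁ hv]
        simp
      · rw [add_comm, hsum hv hu, hcard₀ hv, hcard₁ hu]
        simp
end

section
/- A finite simple graph G admits a 2-uniform integer additive set-indexer (i.e., an IASI f with |f⁺(uv)| = 2 for every edge uv of G) if and only if G is bipartite. -/
open scoped Pointwise

/-- If a sumset of two nonempty finite sets of naturals has two elements, then exactly one of the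
summands is a singleton. -/
theorem card_eq_one_iff_card_ne_one_of_card_add_eq_two {A B : Finset ℕ} (hA : A.Nonempty)
    (hB : B.Nonempty) (h : (A + B).card = 2) : A.card = 1 ↔ B.card ≠ 1 := by
  have lower := cauchy_davenport_add_of_linearOrder_isCancelAdd hA hB
  have upper : (A + B).card ≤ A.card * B.card := Finset.card_add_le
  have hA' := hA.card_pos
  have hB' := hB.card_pos
  constructor
  · intro h1 h2
    rw [h1, h2] at upper
    omega
  · intro h2
    by_contra h1
    omega

theorem pair_succ_injective {a b : ℕ} (h : ({a, a + 1} : Finset ℕ) = {b, b + 1}) : a = b := by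
  have ha : a ∈ ({b, b + 1} : Finset ℕ) := h ▸ by simp
  have hb : b ∈ ({a, a + 1} : Finset ℕ) := h ▸ by simp
  simp only [Finset.mem_insert, Finset.mem_singleton] at ha hb
  omega

/-- Label one side of a bipartition by singletons `{i}` and the other by pairs
`{n * i, n * i + 1}`. -/
def bipartiteLabel {V : Type*} {n : ℕ} (c : V → Prop) [DecidablePred c] (e : V → Fin n) (v : V) :
    Finset ℕ :=
  if c v then {(e v : ℕ)} else {n * e v, n * e v + 1}

section bipartiteLabel

variable {V : Type*} {n : ℕ} {c : V → Prop} [DecidablePred c] {e : V → Fin n}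

theorem bipartiteLabel_nonempty (v : V) : (bipartiteLabel c e v).Nonempty := by
  unfold bipartiteLabel
  split_ifs <;> simp

theorem bipartiteLabel_injective (he : Function.Injective e) :
    Function.Injective (bipartiteLabel c e) := by
  intro u v h
  have hn : 0 < n := (e u).pos
  have card_eq := congrArg Finset.card h
  unfold bipartiteLabel at h card_eq
  split_ifs at h card_eq
  · exact he (Fin.ext (Finset.singleton_injective h))
  · simp at card_eq
  · simp at card_eq
  · exact he (Fin.ext (Nat.eq_of_mul_eq_mul_left hn (pair_succ_injective h)))

theorem bipartiteLabel_add {u v : V} (hu : c u) (hv : ¬ c v) :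
    bipartiteLabel c e u + bipartiteLabel c e v =
      {(e u : ℕ) + n * e v, (e u : ℕ) + n * e v + 1} := by
  simp [bipartiteLabel, hu, hv, Finset.singleton_add, Finset.vadd_finset_insert, add_assoc]

theorem bipartiteLabel_add_injective (he : Function.Injective e) {u v u' v' : V} (hu : c u)
    (hv : ¬ c v) (hu' : c u') (hv' : ¬ c v')
    (h : bipartiteLabel c e u + bipartiteLabel c e v =
      bipartiteLabel c e u' + bipartiteLabel c e v') : u = u' ∧ v = v' := by
  rw [bipartiteLabel_add hu hv, bipartiteLabel_add hu' hv'] at h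
  have key := pair_succ_injective h
  have hn : 0 < n := (e u).pos
  have hmod := congrArg (· % n) key
  simp only [Nat.add_mul_mod_self_left, Nat.mod_eq_of_lt (e u).isLt,
    Nat.mod_eq_of_lt (e u').isLt] at hmod
  rw [hmod] at key
  exact ⟨he (Fin.ext hmod), he (Fin.ext (Nat.eq_of_mul_eq_mul_left hn (Nat.add_left_cancel key)))⟩

end bipartiteLabel

/-- A finite simple graph admits a 2-uniform IASI (an IASI `f` with `|f⁺(uv)| = 2`
for every edge `uv`) iff it is bipartite. -/
theorem two_uniform_IASI_iff_bipartite {V : Type*} [Fintype V] (G : SimpleGraph V) :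
    (∃ f : V → Finset ℕ, Function.Injective f ∧ (∀ v, (f v).Nonempty) ∧
      (∀ u v u' v', G.Adj u v → G.Adj u' v' →
        f u + f v = f u' + f v' → s(u, v) = s(u', v')) ∧
      (∀ u v, G.Adj u v → (f u + f v).card = 2)) ↔
    G.Colorable 2 := by
  constructor
  · rintro ⟨f, -, hne, -, hcard⟩
    refine ⟨SimpleGraph.Coloring.mk (fun v => if (f v).card = 1 then 0 else 1) ?_⟩
    intro u v huv
    have := card_eq_one_iff_card_ne_one_of_card_add_eq_two (hne u) (hne v) (hcard u v huv)
    by_cases hv : (f v).card = 1 <;> simp_all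
  · rintro ⟨C⟩
    have he := (Fintype.equivFin V).injective
    have hC : ∀ u v, G.Adj u v → (C u = 0 ∧ ¬ C v = 0) ∨ (C v = 0 ∧ ¬ C u = 0) := by
      intro u v huv
      have := C.valid huv
      omega
    refine ⟨bipartiteLabel (fun v => C v = 0) (Fintype.equivFin V), bipartiteLabel_injective he,
      bipartiteLabel_nonempty, ?_, ?_⟩
    · intro u v u' v' huv huv' h
      rcases hC u v huv with ⟨h1, h2⟩ | ⟨h1, h2⟩ <;>
        rcases hC u' v' huv' with ⟨h3, h4⟩ | ⟨h3, h4⟩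
      · obtain ⟨rfl, rfl⟩ := bipartiteLabel_add_injective he h1 h2 h3 h4 h
        rfl
      · rw [add_comm (bipartiteLabel _ _ u')] at h
        obtain ⟨rfl, rfl⟩ := bipartiteLabel_add_injective he h1 h2 h3 h4 h
        exact Sym2.eq_swap
      · rw [add_comm (bipartiteLabel _ _ u)] at h
        obtain ⟨rfl, rfl⟩ := bipartiteLabel_add_injective he h1 h2 h3 h4 h
        exact Sym2.eq_swap
      · rw [add_comm (bipartiteLabel _ _ u), add_comm (bipartiteLabel _ _ u')] at h
        obtain ⟨rfl, rfl⟩ := bipartiteLabel_add_injective he h1 h2 h3 h4 h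
        rfl
    · intro u v huv
      rcases hC u v huv with ⟨h1, h2⟩ | ⟨h1, h2⟩
      · rw [bipartiteLabel_add (c := fun v => C v = 0) h1 h2]
        simp
      · rw [add_comm, bipartiteLabel_add (c := fun v => C v = 0) h1 h2]
        simp
end

section
/- Let f be an integer additive set-indexer of a finite simple graph G. Then f is a strong IASI (i.e., |f⁺(uv)| = |f(u)| · |f(v)| for every edge uv of G) if and only if for every edge uv of G the difference sets of the set-labels f(u) and f(v) are disjoint. -/
open scoped Pointwise

/-- The difference set of a finite set of non-negative integers: all (positive)
differences between two distinct elements. -/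
def diffSet (A : Finset ℕ) : Finset ℕ :=
  ((A ×ˢ A).filter fun p => p.1 < p.2).image fun p => p.2 - p.1

theorem mem_diffSet {A : Finset ℕ} {d : ℕ} :
    d ∈ diffSet A ↔ ∃ a ∈ A, ∃ b ∈ A, a < b ∧ b - a = d := by
  simp only [diffSet, Finset.mem_image, Finset.mem_filter, Finset.mem_product, Prod.exists]
  grind

theorem card_add_eq_mul_iff_disjoint_diffSet (A B : Finset ℕ) :
    (A + B).card = A.card * B.card ↔ Disjoint (diffSet A) (diffSet B) := by
  rw [Finset.card_add_iff, Finset.disjoint_left]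
  constructor
  · intro h d hA hB
    obtain ⟨a, ha, a', ha', hlt, rfl⟩ := mem_diffSet.1 hA
    obtain ⟨b, hb, b', hb', hlt', heq⟩ := mem_diffSet.1 hB
    have key := @h (a, b') ⟨ha, hb'⟩ (a', b) ⟨ha', hb⟩ (by dsimp only; omega)
    exact hlt.ne (congrArg Prod.fst key)
  · rintro h ⟨a, b⟩ ⟨ha, hb⟩ ⟨a', b'⟩ ⟨ha', hb'⟩ heq
    dsimp only at ha hb ha' hb' heq
    rcases lt_trichotomy a a' with hlt | rfl | hlt
    · exact (h (mem_diffSet.2 ⟨a, ha, a', ha', hlt, rfl⟩)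
        (mem_diffSet.2 ⟨b', hb', b, hb, by omega, by omega⟩)).elim
    · exact Prod.ext rfl (Nat.add_left_cancel heq)
    · exact (h (mem_diffSet.2 ⟨a', ha', a, ha, hlt, rfl⟩)
        (mem_diffSet.2 ⟨b, hb, b', hb', by omega, by omega⟩)).elim

/-- An IASI `f` of a graph `G` is a strong IASI (`|f⁺(uv)| = |f u| * |f v|` for every
edge) iff the difference sets of the set-labels of any two adjacent vertices are
disjoint. -/
theorem strong_IASI_iff {V : Type*} [Fintype V] (G : SimpleGraph V) (f : V → Finset ℕ)
    (hinj : Function.Injective f) (hne : ∀ v, (f v).Nonempty)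
    (hedge : ∀ u v u' v', G.Adj u v → G.Adj u' v' →
      f u + f v = f u' + f v' → s(u, v) = s(u', v')) :
    (∀ u v, G.Adj u v → (f u + f v).card = (f u).card * (f v).card) ↔
      (∀ u v, G.Adj u v → Disjoint (diffSet (f u)) (diffSet (f v))) := by
  simp only [card_add_eq_mul_iff_disjoint_diffSet]
end

section
/- Let G be a finite connected simple graph that is not bipartite, and let f be a strongly k-uniform integer additive set-indexer of G (i.e., an IASI with |f⁺(uv)| = |f(u)| · |f(v)| = k for every edge uv). Then there is a positive integer l with l² = k such that every vertex of G has a set-label of cardinality l; that is, f is a (k, l)-completely uniform IASI with k = l². -/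
open scoped Pointwise

/-- If a positive weight function on the vertices of a connected non-bipartite graph has the same
product `k` along every edge, then it is constant with square `k`. -/
theorem SimpleGraph.Connected.exists_const_of_mul_eq {V : Type*} {G : SimpleGraph V}
    (hconn : G.Connected) (hnb : ¬ G.Colorable 2) {g : V → ℕ} {k : ℕ} (hpos : ∀ v, 0 < g v)
    (hmul : ∀ u v, G.Adj u v → g u * g v = k) :
    ∃ l : ℕ, 0 < l ∧ l * l = k ∧ ∀ v, g v = l := by
  obtain ⟨r⟩ := hconn.nonempty
  have hval : ∀ v, g v = g r ∨ g v * g r = k := by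
    intro v
    obtain ⟨p⟩ := hconn.preconnected v r
    induction p with
    | nil => exact Or.inl rfl
    | @cons u w r h _ ih =>
      have huw := hmul u w h
      rcases ih with hw | hw
      · exact Or.inr (hw ▸ huw)
      · refine Or.inl (Nat.eq_of_mul_eq_mul_right (hpos w) ?_)
        rw [huw, mul_comm, hw]
  obtain ⟨u, v, huv, hsame⟩ : ∃ u v, G.Adj u v ∧ (g u = g r ↔ g v = g r) := by
    by_contra! hcol
    refine hnb (SimpleGraph.Coloring.mk (fun v => decide (g v = g r)) ?_ : G.Coloring Bool).colorable
    intro u v huv heq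
    have := hcol u v huv
    have := decide_eq_decide.mp heq
    tauto
  have hk := hmul u v huv
  have hsq : g r * g r = k := by
    by_cases hu : g u = g r
    · rwa [hsame.mp hu, hu] at hk
    · have hur := (hval u).resolve_left hu
      have hvr := (hval v).resolve_left (mt hsame.mpr hu)
      exact absurd (Nat.eq_of_mul_eq_mul_right (hpos v)
        (by rw [hk, mul_comm, hvr])) hu
  refine ⟨g r, hpos r, hsq, fun w => (hval w).elim id fun hw => ?_⟩
  exact Nat.eq_of_mul_eq_mul_right (hpos r) (hw.trans hsq.symm)

/-- If a finite connected non-bipartite graph admits a strongly `k`-uniform IASI,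
then `k = l²` for some `l` and every vertex is `l`-uniformly set-indexed; that is,
the IASI is `(k, l)`-completely uniform with `k = l²`. -/
theorem strongly_uniform_IASI_of_not_bipartite {V : Type*} [Fintype V]
    (G : SimpleGraph V) (hconn : G.Connected) (hnb : ¬ G.Colorable 2)
    (f : V → Finset ℕ) (k : ℕ)
    (hinj : Function.Injective f) (hne : ∀ v, (f v).Nonempty)
    (hedge : ∀ u v u' v', G.Adj u v → G.Adj u' v' →
      f u + f v = f u' + f v' → s(u, v) = s(u', v'))
    (hstrong : ∀ u v, G.Adj u v →
      (f u + f v).card = (f u).card * (f v).card ∧ (f u + f v).card = k) :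
    ∃ l : ℕ, 0 < l ∧ l * l = k ∧ ∀ v, (f v).card = l := by
  exact hconn.exists_const_of_mul_eq hnb (fun v => (hne v).card_pos)
    fun u v huv => (hstrong u v huv).1.symm.trans (hstrong u v huv).2
end
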